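/- Let F be the Fibonacci sequence with F₁ = F₂ = 1 and F_{k+1} = F_k + F_{k−1}, and for n ≥ 1 let U_n ⊆ [0,1]² be the triangle with vertices (0,0), (1/F_n, 0), and (n/F_{n+1}, 1/F_{n+1}). Then for every n ≥ 1 there exists a Z-retraction σ of [0,1]² with range U_n such that the set of Z-homeomorphism domains for σ has at least 2ⁿ elements; moreover, for every Z-retraction of [0,1]² with range U_n the set of its Z-homeomorphism domains is finite. In particular, for every j there is a retract of McN([0,1]²) whose multiplicity is finite and greater than j. -/

import Mathlib

open Set MeasureTheory

/-- The unit cube `[0,1]^n` in `ℝ^n`. -/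
def cubeSet (n : ℕ) : Set (Fin n → ℝ) := Set.Icc 0 1

/-- A point all of whose coordinates are rational. -/
def IsRationalPoint {n : ℕ} (v : Fin n → ℝ) : Prop := ∀ i, ∃ q : ℚ, v i = (q : ℝ)

/-- A rational polyhedron: a finite union of convex hulls of finite sets of rational points. -/
def IsRationalPolyhedron {n : ℕ} (P : Set (Fin n → ℝ)) : Prop :=
  ∃ S : Finset (Finset (Fin n → ℝ)),
    (∀ F ∈ S, ∀ v ∈ F, IsRationalPoint v) ∧
    P = ⋃ F ∈ S, convexHull ℝ (F : Set (Fin n → ℝ))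

/-- An affine map `x ↦ Mx + b` with integer matrix `M` and integer vector `b`. -/
def IsIntAffine {n m : ℕ} (g : (Fin n → ℝ) → (Fin m → ℝ)) : Prop :=
  ∃ (M : Fin m → Fin n → ℤ) (b : Fin m → ℤ),
    ∀ x i, g x i = (∑ j, (M i j : ℝ) * x j) + (b i : ℝ)

/-- A Z-map on `P`: continuous on `P`, with finitely many integer affine pieces. -/
def IsZMapOn {n m : ℕ} (P : Set (Fin n → ℝ)) (f : (Fin n → ℝ) → (Fin m → ℝ)) : Prop :=
  ContinuousOn f P ∧
  ∃ (k : ℕ) (g : Fin k → (Fin n → ℝ) → (Fin m → ℝ)),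
    (∀ i, IsIntAffine (g i)) ∧ ∀ x ∈ P, ∃ i, f x = g i x

/-- `f` restricted to `P` is a Z-homeomorphism of `P` onto `Q`. -/
def IsZHomeoOnto {n m : ℕ} (P : Set (Fin n → ℝ)) (Q : Set (Fin m → ℝ))
    (f : (Fin n → ℝ) → (Fin m → ℝ)) : Prop :=
  IsZMapOn P f ∧ f '' P = Q ∧ Set.InjOn f P ∧
  ∃ g : (Fin m → ℝ) → (Fin n → ℝ),
    IsZMapOn Q g ∧ (∀ x ∈ P, g (f x) = x) ∧ (∀ y ∈ Q, f (g y) = y)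

/-- A Z-retraction of the cube `[0,1]^n`. -/
def IsZRetraction {n : ℕ} (σ : (Fin n → ℝ) → (Fin n → ℝ)) : Prop :=
  IsZMapOn (cubeSet n) σ ∧ Set.MapsTo σ (cubeSet n) (cubeSet n) ∧
  ∀ x ∈ cubeSet n, σ (σ x) = σ x

/-- The range `R_σ = σ([0,1]^n)` of a Z-retraction. -/
def zRange {n : ℕ} (σ : (Fin n → ℝ) → (Fin n → ℝ)) : Set (Fin n → ℝ) := σ '' cubeSet n

/-- A Z-homeomorphism domain for `σ`: a rational polyhedron `Q ⊆ [0,1]^n` such that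
`σ` restricted to `Q` is a Z-homeomorphism of `Q` onto `R_σ`. -/
def IsZHomeoDomain {n : ℕ} (σ : (Fin n → ℝ) → (Fin n → ℝ)) (Q : Set (Fin n → ℝ)) : Prop :=
  IsRationalPolyhedron Q ∧ Q ⊆ cubeSet n ∧ IsZHomeoOnto Q (zRange σ) σ

/-- A (Kuratowski) closed domain: `D` equals the closure of its interior. -/
def IsClosedDomain {n : ℕ} (D : Set (Fin n → ℝ)) : Prop :=
  closure (interior D) = D

/-- A scalar integer affine map. -/
def IsIntAffine1 {n : ℕ} (g : (Fin n → ℝ) → ℝ) : Prop :=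
  ∃ (m : Fin n → ℤ) (b : ℤ), ∀ x, g x = (∑ j, (m j : ℝ) * x j) + (b : ℝ)

/-- A scalar Z-map on `P`. -/
def IsZMapOn1 {n : ℕ} (P : Set (Fin n → ℝ)) (f : (Fin n → ℝ) → ℝ) : Prop :=
  ContinuousOn f P ∧
  ∃ (k : ℕ) (g : Fin k → (Fin n → ℝ) → ℝ),
    (∀ i, IsIntAffine1 (g i)) ∧ ∀ x ∈ P, ∃ i, f x = g i x

/-- The free MV-algebra `McN([0,1]^n)`, viewed as a set of functions on the cube. -/
def McN (n : ℕ) : Set (↥(cubeSet n) → ℝ) :=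
  { f | (∀ x, f x ∈ Set.Icc (0:ℝ) 1) ∧
    ∃ g : (Fin n → ℝ) → ℝ, IsZMapOn1 (cubeSet n) g ∧ ∀ x : ↥(cubeSet n), f x = g x.1 }

/-- Pointwise MV-sum `f ⊕ g = min(f + g, 1)`. -/
def mvAdd {X : Type*} (f g : X → ℝ) : X → ℝ := fun x => min (f x + g x) 1

/-- Pointwise MV-negation `¬f = 1 - f`. -/
def mvNeg {X : Type*} (f : X → ℝ) : X → ℝ := fun x => 1 - f x

/-- The retract `A_σ = {g ∘ σ : g ∈ McN([0,1]^n)}` associated with a Z-retraction `σ`. -/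
def retAlg {n : ℕ} (σ : (Fin n → ℝ) → (Fin n → ℝ)) : Set (↥(cubeSet n) → ℝ) :=
  { f | ∃ g ∈ McN n, ∀ (x : ↥(cubeSet n)) (h : σ x.1 ∈ cubeSet n), f x = g ⟨σ x.1, h⟩ }

/-- `ε` is a retraction of `McN([0,1]^n)` onto `A`. -/
def IsMcNRetraction {n : ℕ} (ε : ↥(McN n) → ↥(McN n)) (A : Set (↥(cubeSet n) → ℝ)) : Prop :=
  (∀ (f g : ↥(McN n)) (h : mvAdd f.1 g.1 ∈ McN n),
      (ε ⟨mvAdd f.1 g.1, h⟩).1 = mvAdd (ε f).1 (ε g).1) ∧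
  (∀ (f : ↥(McN n)) (h : mvNeg f.1 ∈ McN n),
      (ε ⟨mvNeg f.1, h⟩).1 = mvNeg (ε f).1) ∧
  (∀ f, ε (ε f) = ε f) ∧
  Subtype.val '' Set.range ε = A

/-- An MV-isomorphism between two sets of `[0,1]`-valued functions. -/
def IsMVIsoFun {X Y : Type*} (A : Set (X → ℝ)) (B : Set (Y → ℝ)) (h : ↥A → ↥B) : Prop :=
  Function.Bijective h ∧
  (∀ (f g : ↥A) (hm : mvAdd f.1 g.1 ∈ A),
      (h ⟨mvAdd f.1 g.1, hm⟩).1 = mvAdd (h f).1 (h g).1) ∧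
  (∀ (f : ↥A) (hm : mvNeg f.1 ∈ A),
      (h ⟨mvNeg f.1, hm⟩).1 = mvNeg (h f).1)

/-- The triangle `U_n` with vertices `(0,0)`, `(1/F_n, 0)` and `(n/F_{n+1}, 1/F_{n+1})`,
where `F` is the Fibonacci sequence (`F₁ = F₂ = 1`, `F_{k+1} = F_k + F_{k-1}`). -/
def Utri (n : ℕ) : Set (Fin 2 → ℝ) :=
  convexHull ℝ {![0, 0], ![1 / (Nat.fib n : ℝ), 0],
    ![(n : ℝ) / (Nat.fib (n + 1) : ℝ), 1 / (Nat.fib (n + 1) : ℝ)]}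

theorem convex_setOf_sign_affineMap_eq {E : Type*} [AddCommGroup E] [Module ℝ E]
    (f : E →ᵃ[ℝ] ℝ) (e : SignType) : Convex ℝ {u | SignType.sign (f u) = e} := by
  have key : ∀ s : Set ℝ, Convex ℝ s → Convex ℝ (f ⁻¹' s) := fun s hs => hs.affine_preimage f
  cases e
  · convert key {0} (convex_singleton 0) using 1
    ext u; simp [sign_eq_zero_iff]
  · convert key (Set.Iio 0) (convex_Iio 0) using 1
    ext u; exact sign_eq_neg_one_iff
  · convert key (Set.Ioi 0) (convex_Ioi 0) using 1
    ext u; exact sign_eq_one_iff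

theorem volume_setOf_affineMap_eq_zero {n : ℕ} (f : (Fin n → ℝ) →ᵃ[ℝ] ℝ) (hf : f ≠ 0) :
    volume {u | f u = 0} = 0 := by
  have := Measure.addHaar_affineSubspace (volume : Measure (Fin n → ℝ))
    ((AffineSubspace.mk' (0 : ℝ) ⊥).comap f) ?_
  · convert this using 2
    ext u; simp
  · intro h
    apply hf
    ext u
    have : u ∈ (AffineSubspace.mk' (0 : ℝ) ⊥).comap f := by rw [h]; trivial
    simpa using this

theorem exists_eqOn_of_isPreconnected {X Y ι : Type*} [TopologicalSpace X] [TopologicalSpace Y]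
    [T2Space Y] [Finite ι] {C : Set X} (hC : IsPreconnected C) {s : X → Y} {h : ι → X → Y}
    (hs : ContinuousOn s C) (hh : ∀ i, ContinuousOn (h i) C) (hsel : ∀ u ∈ C, ∃ i, s u = h i u)
    (hsep : ∀ i j, ∀ u ∈ C, h i u = h j u → EqOn (h i) (h j) C) {u : X} (hu : u ∈ C) :
    ∃ i, EqOn s (h i) C := by
  obtain ⟨i, hi⟩ := hsel u hu
  refine ⟨i, ?_⟩
  have := isPreconnected_iff_preconnectedSpace.1 hC
  have hcl : ∀ j, IsClosed {v : C | s v = h j v} := fun j =>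
    isClosed_eq hs.domRestrict (hh j).domRestrict
  have hcompl : {v : C | s v = h i v}ᶜ =
      ⋃ j ∈ {j | ¬ EqOn (h i) (h j) C}, {v : C | s v = h j v} := by
    ext v
    simp only [mem_compl_iff, mem_ofPred_eq, mem_iUnion, exists_prop]
    constructor
    · intro hv
      obtain ⟨j, hj⟩ := hsel v v.2
      exact ⟨j, fun hij => hv (hj.trans (hij v.2).symm), hj⟩
    · rintro ⟨j, hij, hj⟩ hv
      exact hij (hsep i j v v.2 (hv.symm.trans hj))
  have hclopen : IsClopen {v : C | s v = h i v} := by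
    refine ⟨hcl i, ?_⟩
    rw [← isClosed_compl_iff, hcompl]
    exact (Set.toFinite _).isClosed_biUnion fun j _ => hcl j
  rcases isClopen_iff.1 hclopen with h0 | h1
  · exact absurd (h0 ▸ (show (⟨u, hu⟩ : C) ∈ {v : C | s v = h i v} from hi)) (by simp)
  · intro v hv
    have : (⟨v, hv⟩ : C) ∈ {v : C | s v = h i v} := h1 ▸ mem_univ _
    exact this

theorem finite_image_of_affine_selection {n : ℕ} {ι : Type*} [Finite ι]
    (h : ι → (Fin n → ℝ) →ᵃ[ℝ] (Fin n → ℝ)) (l : ι → (Fin n → ℝ) →ᵃ[ℝ] ℝ)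
    (hl : ∀ i, l i ≠ 0) {U : Set (Fin n → ℝ)} (hU : Convex ℝ U)
    (hUi : U ⊆ closure (interior U)) :
    {Q : Set (Fin n → ℝ) | ∃ s : (Fin n → ℝ) → (Fin n → ℝ), ContinuousOn s U ∧
      (∀ u ∈ U, (∀ i, l i u ≠ 0) → ∃ i, s u = h i u) ∧ s '' U = Q}.Finite := by
  let sgn : (Fin n → ℝ) → (ι × ι × Fin n ⊕ ι) → SignType := fun u m =>
    SignType.sign (Sum.elim (fun p => h p.1 u p.2.2 - h p.2.1 u p.2.2) (fun i => l i u) m)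
  let G : Set (Fin n → ℝ) := {u | u ∈ U ∧ ∀ i, l i u ≠ 0}
  let C : ((ι × ι × Fin n ⊕ ι) → SignType) → Set (Fin n → ℝ) := fun e => {u | u ∈ U ∧ sgn u = e}
  have hCconv : ∀ e, Convex ℝ (C e) := by
    intro e
    have : C e = U ∩ ⋂ m, {u | sgn u m = e m} := by
      ext u; simp only [C, funext_iff, mem_inter_iff, mem_iInter, mem_ofPred_eq]
    rw [this]
    refine hU.inter (convex_iInter fun m => ?_)
    rcases m with ⟨i, j, c⟩ | i
    · exact convex_setOf_sign_affineMap_eq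
        ((LinearMap.proj c : (Fin n → ℝ) →ₗ[ℝ] ℝ).toAffineMap.comp (h i - h j)) _
    · exact convex_setOf_sign_affineMap_eq (l i) _
  have hsepC : ∀ e i j, ∀ u ∈ C e, h i u = h j u → EqOn (h i) (h j) (C e) := by
    intro e i j u hu hij v hv
    ext c
    have h1 := congrFun (hu.2.trans hv.2.symm) (.inl (i, j, c))
    simp only [sgn, Sum.elim_inl, hij, sub_self, sign_zero] at h1
    exact sub_eq_zero.1 (sign_eq_zero_iff.1 h1.symm)
  have hGC : ∀ u ∈ G, C (sgn u) ⊆ G := by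
    intro u hu v hv
    refine ⟨hv.1, fun i hi => hu.2 i ?_⟩
    have h1 := congrFun hv.2 (.inr i)
    simp only [sgn, Sum.elim_inr, hi, sign_zero] at h1
    exact sign_eq_zero_iff.1 h1.symm
  have hae : ∀ᵐ u ∂(volume.restrict U), u ∈ G := by
    have hne : ∀ i, ∀ᵐ u ∂(volume : Measure (Fin n → ℝ)), l i u ≠ 0 := fun i => by
      rw [ae_iff]
      simpa using volume_setOf_affineMap_eq_zero (l i) (hl i)
    filter_upwards [ae_restrict_mem₀ (hU.nullMeasurableSet volume),
      ae_restrict_of_ae (ae_all_iff.2 hne)] with u hu hu'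
    exact ⟨hu, hu'⟩
  choose! s hs using fun Q (hQ : Q ∈ {Q : Set (Fin n → ℝ) | ∃ s : (Fin n → ℝ) → (Fin n → ℝ),
    ContinuousOn s U ∧ (∀ u ∈ U, (∀ i, l i u ≠ 0) → ∃ i, s u = h i u) ∧ s '' U = Q}) => hQ
  refine Set.Finite.of_injOn (t := univ)
    (f := fun Q => {p : ((ι × ι × Fin n ⊕ ι) → SignType) × ι | EqOn (s Q) (h p.2) (C p.1)})
    (mapsTo_univ _ _) ?_ finite_univ
  intro Q hQ Q' hQ' heq
  have hEq : EqOn (s Q) (s Q') U := by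
    refine Measure.eqOn_of_ae_eq (μ := volume) ?_ (hs Q hQ).1 (hs Q' hQ').1 hUi
    filter_upwards [hae] with u hu
    have huC : u ∈ C (sgn u) := ⟨hu.1, rfl⟩
    obtain ⟨i, hi⟩ := exists_eqOn_of_isPreconnected (hCconv (sgn u)).isPreconnected
      (s := s Q) (h := fun i => h i) ((hs Q hQ).1.mono fun v hv => hv.1)
      (fun i => (h i).continuous_of_finiteDimensional.continuousOn)
      (fun v hv => (hs Q hQ).2.1 v hv.1 (hGC u hu hv).2) (hsepC _) huC
    have h2 : (sgn u, i) ∈ {p : ((ι × ι × Fin n ⊕ ι) → SignType) × ι |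
      EqOn (s Q') (h p.2) (C p.1)} := by
      rw [← show _ = {p : ((ι × ι × Fin n ⊕ ι) → SignType) × ι |
        EqOn (s Q') (h p.2) (C p.1)} from heq]
      exact hi
    exact (hi huC).trans (h2 huC).symm
  rw [← (hs Q hQ).2.2, ← (hs Q' hQ').2.2]
  exact hEq.image_eq

theorem IsIntAffine.exists_affine_inverse {n : ℕ} {g : (Fin n → ℝ) → (Fin n → ℝ)}
    (hg : IsIntAffine g) :
    ∃ (h : (Fin n → ℝ) →ᵃ[ℝ] (Fin n → ℝ)) (l : (Fin n → ℝ) →ᵃ[ℝ] ℝ),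
      l ≠ 0 ∧ ∀ x, l (g x) ≠ 0 → x = h (g x) := by
  obtain ⟨M, b, hM⟩ := hg
  let A : Matrix (Fin n) (Fin n) ℝ := Matrix.of fun i j => (M i j : ℝ)
  let c : Fin n → ℝ := fun i => b i
  have hgA : ∀ x, g x - c = A.mulVec x := fun x => by
    ext i
    simp [hM, A, c, Matrix.mulVec, dotProduct]
  let t : (Fin n → ℝ) →ᵃ[ℝ] (Fin n → ℝ) := AffineMap.id ℝ _ - AffineMap.const ℝ _ c
  by_cases hdet : A.det = 0
  · obtain ⟨v, hv, hvA⟩ := Matrix.exists_vecMul_eq_zero_iff.2 hdet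
    refine ⟨t, (dotProductBilin ℝ ℝ v).toAffineMap.comp t, ?_, ?_⟩
    · intro h0
      have := DFunLike.congr_fun h0 (v + c)
      simp [t] at this
      exact hv this
    · intro x hx
      refine absurd ?_ hx
      simp [t, hgA, Matrix.dotProduct_mulVec, hvA]
  · refine ⟨A⁻¹.mulVecLin.toAffineMap.comp t, AffineMap.const ℝ _ 1, ?_, ?_⟩
    · intro h0
      simpa using DFunLike.congr_fun h0 0
    · intro x _
      simp [t, hgA, Matrix.nonsing_inv_mul A (Ne.isUnit hdet)]

theorem finite_setOf_isZHomeoDomain {n : ℕ} {σ : (Fin n → ℝ) → (Fin n → ℝ)}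
    (hσ : IsZRetraction σ) (hconv : Convex ℝ (zRange σ))
    (hint : zRange σ ⊆ closure (interior (zRange σ))) :
    {Q : Set (Fin n → ℝ) | IsZHomeoDomain σ Q}.Finite := by
  obtain ⟨⟨-, k, g, hg, hσg⟩, -, -⟩ := hσ
  choose h l hl hinv using fun i => (hg i).exists_affine_inverse
  refine (finite_image_of_affine_selection h l hl hconv hint).subset ?_
  rintro Q ⟨-, hQ, -, himg, -, s, hs, hsσ, hσs⟩
  have hsQ : s '' zRange σ = Q := by
    rw [← himg, image_image]
    exact (image_congr hsσ).trans (image_id' Q)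
  refine ⟨s, hs.1, fun u hu hne => ?_, hsQ⟩
  obtain ⟨i, hi⟩ := hσg (s u) (hQ (hsQ ▸ mem_image_of_mem s hu))
  rw [hσs u hu] at hi
  refine ⟨i, ?_⟩
  have := hinv i (s u) (hi ▸ hne i)
  rwa [← hi] at this

theorem IsIntAffine.continuous {n m : ℕ} {g : (Fin n → ℝ) → (Fin m → ℝ)} (hg : IsIntAffine g) :
    Continuous g := by
  obtain ⟨M, b, h⟩ := hg
  refine continuous_pi fun i => ?_
  simp only [h]
  fun_prop

theorem IsIntAffine.comp {n m l : ℕ} {g : (Fin m → ℝ) → (Fin l → ℝ)}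
    {f : (Fin n → ℝ) → (Fin m → ℝ)} (hg : IsIntAffine g) (hf : IsIntAffine f) :
    IsIntAffine (g ∘ f) := by
  obtain ⟨M, b, hM⟩ := hg
  obtain ⟨N, c, hN⟩ := hf
  refine ⟨fun i j => ∑ k, M i k * N k j, fun i => ∑ k, M i k * c k + b i, fun x i => ?_⟩
  simp only [Function.comp_apply, hM, hN, mul_add, Finset.sum_add_distrib, Finset.mul_sum,
    Int.cast_sum, Int.cast_mul, Int.cast_add, Finset.sum_mul]
  rw [Finset.sum_comm]
  simp only [mul_assoc, add_assoc]

theorem isZMapOn_of_finite {n m : ℕ} {ι : Type*} [Finite ι] {P : Set (Fin n → ℝ)}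
    {f : (Fin n → ℝ) → (Fin m → ℝ)} (hf : ContinuousOn f P)
    (g : ι → (Fin n → ℝ) → (Fin m → ℝ)) (hg : ∀ i, IsIntAffine (g i))
    (hfg : ∀ x ∈ P, ∃ i, f x = g i x) : IsZMapOn P f := by
  obtain ⟨k, ⟨e⟩⟩ := Finite.exists_equiv_fin ι
  refine ⟨hf, k, fun i => g (e.symm i), fun i => hg _, fun x hx => ?_⟩
  obtain ⟨i, hi⟩ := hfg x hx
  exact ⟨e i, by simpa using hi⟩

theorem isZMapOn1_of_finite {n : ℕ} {ι : Type*} [Finite ι] {P : Set (Fin n → ℝ)}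
    {f : (Fin n → ℝ) → ℝ} (hf : ContinuousOn f P)
    (g : ι → (Fin n → ℝ) → ℝ) (hg : ∀ i, IsIntAffine1 (g i))
    (hfg : ∀ x ∈ P, ∃ i, f x = g i x) : IsZMapOn1 P f := by
  obtain ⟨k, ⟨e⟩⟩ := Finite.exists_equiv_fin ι
  refine ⟨hf, k, fun i => g (e.symm i), fun i => hg _, fun x hx => ?_⟩
  obtain ⟨i, hi⟩ := hfg x hx
  exact ⟨e i, by simpa using hi⟩

theorem IsIntAffine.isZMapOn {n m : ℕ} {P : Set (Fin n → ℝ)} {g : (Fin n → ℝ) → (Fin m → ℝ)}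
    (hg : IsIntAffine g) : IsZMapOn P g :=
  isZMapOn_of_finite (ι := Unit) hg.continuous.continuousOn (fun _ => g) (fun _ => hg)
    fun _ _ => ⟨(), rfl⟩

theorem IsZMapOn.mono {n m : ℕ} {P P' : Set (Fin n → ℝ)} {f : (Fin n → ℝ) → (Fin m → ℝ)}
    (hf : IsZMapOn P f) (h : P' ⊆ P) : IsZMapOn P' f := by
  obtain ⟨hc, k, g, hg, hfg⟩ := hf
  exact ⟨hc.mono h, k, g, hg, fun x hx => hfg x (h hx)⟩

theorem IsZMapOn.comp {n m l : ℕ} {P : Set (Fin n → ℝ)} {P' : Set (Fin m → ℝ)}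
    {g : (Fin m → ℝ) → (Fin l → ℝ)} {f : (Fin n → ℝ) → (Fin m → ℝ)} (hg : IsZMapOn P' g)
    (hf : IsZMapOn P f) (hmaps : MapsTo f P P') : IsZMapOn P (g ∘ f) := by
  obtain ⟨hgc, k, a, ha, hga⟩ := hg
  obtain ⟨hfc, k', b, hb, hfb⟩ := hf
  refine isZMapOn_of_finite (hgc.comp hfc hmaps) (fun p : Fin k × Fin k' => a p.1 ∘ b p.2)
    (fun p => (ha p.1).comp (hb p.2)) fun x hx => ?_
  obtain ⟨j, hj⟩ := hfb x hx
  obtain ⟨i, hi⟩ := hga (f x) (hmaps hx)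
  exact ⟨(i, j), by simp [hi, ← hj]⟩

theorem IsZMapOn.of_apply {n m : ℕ} {P : Set (Fin n → ℝ)} {f : (Fin n → ℝ) → (Fin m → ℝ)}
    (hf : ∀ i, IsZMapOn1 P fun x => f x i) : IsZMapOn P f := by
  choose hc k g hg hfg using hf
  refine isZMapOn_of_finite (continuousOn_pi.2 hc)
    (fun (p : ∀ i, Fin (k i)) x i => g i (p i) x) (fun p => ?_) fun x hx => ?_
  · choose M b h using fun i => hg i (p i)
    exact ⟨M, b, fun x i => h i x⟩
  · choose p hp using fun i => hfg i x hx
    exact ⟨p, funext hp⟩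

theorem isZMapOn1_apply {n : ℕ} (P : Set (Fin n → ℝ)) (i : Fin n) :
    IsZMapOn1 P fun x => x i :=
  isZMapOn1_of_finite (ι := Unit) (continuous_apply i).continuousOn (fun _ x => x i)
    (fun _ => ⟨Pi.single i 1, 0, fun x => by simp [Pi.single_apply]⟩) fun _ _ => ⟨(), rfl⟩

theorem IsZMapOn1.lin_comb {n : ℕ} {P : Set (Fin n → ℝ)} {f g : (Fin n → ℝ) → ℝ}
    (hf : IsZMapOn1 P f) (hg : IsZMapOn1 P g) (p q r : ℤ) :
    IsZMapOn1 P fun x => p * f x + q * g x + r := by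
  obtain ⟨hfc, k, a, ha, hfa⟩ := hf
  obtain ⟨hgc, k', b, hb, hgb⟩ := hg
  refine isZMapOn1_of_finite (by fun_prop)
    (fun (s : Fin k × Fin k') x => p * a s.1 x + q * b s.2 x + r) (fun s => ?_) fun x hx => ?_
  · obtain ⟨M, c, hM⟩ := ha s.1
    obtain ⟨N, d, hN⟩ := hb s.2
    refine ⟨fun j => p * M j + q * N j, p * c + q * d + r, fun x => ?_⟩
    simp only [hM, hN, Int.cast_add, Int.cast_mul, add_mul, Finset.sum_add_distrib, mul_add,
      Finset.mul_sum, mul_assoc]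
    ring
  · obtain ⟨i, hi⟩ := hfa x hx
    obtain ⟨j, hj⟩ := hgb x hx
    exact ⟨(i, j), by rw [hi, hj]⟩

theorem IsZMapOn1.of_select {n : ℕ} {P : Set (Fin n → ℝ)} {f g h : (Fin n → ℝ) → ℝ}
    (hf : IsZMapOn1 P f) (hg : IsZMapOn1 P g) (hc : ContinuousOn h P)
    (hfg : ∀ x, h x = f x ∨ h x = g x) : IsZMapOn1 P h := by
  obtain ⟨hfc, k, a, ha, hfa⟩ := hf
  obtain ⟨hgc, k', b, hb, hgb⟩ := hg
  refine isZMapOn1_of_finite hc (Sum.elim a b) (by rintro (i | i); exacts [ha i, hb i])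
    fun x hx => ?_
  rcases hfg x with h | h
  · obtain ⟨i, hi⟩ := hfa x hx
    exact ⟨.inl i, h.trans hi⟩
  · obtain ⟨i, hi⟩ := hgb x hx
    exact ⟨.inr i, h.trans hi⟩

theorem IsZMapOn1.max {n : ℕ} {P : Set (Fin n → ℝ)} {f g : (Fin n → ℝ) → ℝ}
    (hf : IsZMapOn1 P f) (hg : IsZMapOn1 P g) : IsZMapOn1 P fun x => Max.max (f x) (g x) :=
  hf.of_select hg (ContinuousOn.sup hf.1 hg.1) fun x => max_choice (f x) (g x)

theorem IsZMapOn1.min {n : ℕ} {P : Set (Fin n → ℝ)} {f g : (Fin n → ℝ) → ℝ}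
    (hf : IsZMapOn1 P f) (hg : IsZMapOn1 P g) : IsZMapOn1 P fun x => Min.min (f x) (g x) :=
  hf.of_select hg (ContinuousOn.inf hf.1 hg.1) fun x => min_choice (f x) (g x)

theorem mem_Utri_iff {n : ℕ} (hn : 1 ≤ n) (p : Fin 2 → ℝ) :
    p ∈ Utri n ↔ 0 ≤ p 1 ∧ 0 ≤ p 0 - n * p 1 ∧
      Nat.fib n * (p 0 - n * p 1) + Nat.fib (n + 1) * p 1 ≤ 1 := by
  have hF : (0 : ℝ) < Nat.fib n := by exact_mod_cast Nat.fib_pos.2 hn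
  have hF' : (0 : ℝ) < Nat.fib (n + 1) := by exact_mod_cast Nat.fib_pos.2 n.succ_pos
  rw [Utri, convexHull_insert (by simp), convexHull_pair, mem_convexJoin]
  simp only [mem_singleton_iff, exists_eq_left]
  constructor
  · rintro ⟨q, ⟨a, b, ha, hb, hab, rfl⟩, ⟨c, d, hc, hd, hcd, rfl⟩⟩
    simp only [Pi.add_apply, Pi.smul_apply, smul_eq_mul, Matrix.cons_val_zero,
      Matrix.cons_val_one]
    have e1 : c * 0 + d * (a * (1 / (Nat.fib n : ℝ)) + b * (n / (Nat.fib (n + 1) : ℝ))) -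
        n * (c * 0 + d * (a * 0 + b * (1 / (Nat.fib (n + 1) : ℝ)))) = d * a / Nat.fib n := by
      field_simp; ring
    rw [e1]
    refine ⟨by positivity, by positivity, ?_⟩
    field_simp
    nlinarith
  · rintro ⟨h1, h2, h3⟩
    set B := p 0 - n * p 1 with hB
    by_cases hs : Nat.fib n * B + Nat.fib (n + 1) * p 1 = 0
    · have hB0 : B = 0 := by
        have := mul_nonneg hF.le h2
        have := mul_nonneg hF'.le h1
        have : Nat.fib n * B = 0 := by linarith
        simpa [hF.ne'] using this
      have hC0 : p 1 = 0 := by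
        have : Nat.fib (n + 1) * p 1 = 0 := by rw [hB0] at hs; linarith
        simpa [hF'.ne'] using this
      refine ⟨_, left_mem_segment ℝ _ _, 1, 0, zero_le_one, le_rfl, by simp, ?_⟩
      ext i
      fin_cases i
      · simp; rw [hC0] at hB; linarith
      · simp [hC0]
    · set S := Nat.fib n * B + Nat.fib (n + 1) * p 1 with hS
      have hS0 : 0 < S := lt_of_le_of_ne (by positivity) (Ne.symm hs)
      refine ⟨_, ⟨Nat.fib n * B / S, Nat.fib (n + 1) * p 1 / S, by positivity, by positivity,
        by rw [← add_div, div_self hs], rfl⟩, 1 - S, S, by linarith, hS0.le, by ring, ?_⟩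
      ext i
      fin_cases i
      · simp
        field_simp
        linarith
      · simp
        field_simp

theorem convex_Utri (n : ℕ) : Convex ℝ (Utri n) := convex_convexHull ℝ _

theorem Utri_subset_closure_interior {n : ℕ} (hn : 1 ≤ n) :
    Utri n ⊆ closure (interior (Utri n)) := by
  have hF : (0 : ℝ) < Nat.fib (n + 2) := by exact_mod_cast Nat.fib_pos.2 (by omega)
  have hne : (interior (Utri n)).Nonempty := by
    let V : Set (Fin 2 → ℝ) := {p | 0 < p 1 ∧ 0 < p 0 - n * p 1 ∧
      Nat.fib n * (p 0 - n * p 1) + Nat.fib (n + 1) * p 1 < 1}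
    have hV : IsOpen V := by
      refine IsOpen.and ?_ (IsOpen.and ?_ ?_) <;> exact isOpen_lt (by fun_prop) (by fun_prop)
    refine ⟨![(n + 1) / (2 * Nat.fib (n + 2)), 1 / (2 * Nat.fib (n + 2))],
      interior_maximal (fun p hp => (mem_Utri_iff hn p).2 ⟨hp.1.le, hp.2.1.le, hp.2.2.le⟩) hV ?_⟩
    have e : ((n : ℝ) + 1) / (2 * Nat.fib (n + 2)) - n * (1 / (2 * Nat.fib (n + 2))) =
        1 / (2 * Nat.fib (n + 2)) := by ring
    simp only [V, mem_ofPred_eq, Matrix.cons_val_zero, Matrix.cons_val_one, e]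
    refine ⟨by positivity, by positivity, ?_⟩
    rw [← add_mul, ← Nat.cast_add, ← Nat.fib_add_two]
    field_simp
    norm_num
  rw [(convex_Utri n).closure_interior_eq_closure_of_nonempty_interior hne]
  exact subset_closure

/-- The retraction of `U_n` onto `U_{n+1}` that folds `U_n` along the line through the origin and
the mediant of the two other vertices, and then collapses the excess. -/
def foldMap (n : ℕ) (p : Fin 2 → ℝ) : Fin 2 → ℝ :=
  let c : ℝ := min (p 0 - n * p 1) (p 1)
  let b : ℝ := max (p 0 - n * p 1) (p 1) - c
  ![max 0 (b + min 0 (1 - Nat.fib (n + 1) * b - Nat.fib (n + 2) * c)) + (n + 1) * c, c]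

/-- The involution exchanging the two nonzero vertices of `U_n` up to scaling; it maps `U_{n+1}`
onto the other half of the fold. -/
def swapMap (n : ℕ) (p : Fin 2 → ℝ) : Fin 2 → ℝ :=
  ![p 1 + n * (p 0 - n * p 1), p 0 - n * p 1]

theorem isIntAffine_swapMap (n : ℕ) : IsIntAffine (swapMap n) := by
  refine ⟨![![n, 1 - n * n], ![1, -n]], 0, fun x i => ?_⟩
  fin_cases i <;> simp [swapMap] <;> ring

theorem swapMap_involutive (n : ℕ) : Function.Involutive (swapMap n) := by
  intro p
  ext i
  fin_cases i <;> simp [swapMap]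

theorem foldMap_swapMap (n : ℕ) (p : Fin 2 → ℝ) : foldMap n (swapMap n p) = foldMap n p := by
  simp [foldMap, swapMap, min_comm (p 1), max_comm (p 1)]

theorem isZMapOn_foldMap (n : ℕ) (P : Set (Fin 2 → ℝ)) : IsZMapOn P (foldMap n) := by
  have hB : IsZMapOn1 P fun p => p 0 - n * p 1 := by
    convert (isZMapOn1_apply P 0).lin_comb (isZMapOn1_apply P 1) 1 (-n) 0 using 2
    push_cast; ring
  have hc := hB.min (isZMapOn1_apply P 1)
  have hb : IsZMapOn1 P fun p => max (p 0 - n * p 1) (p 1) - min (p 0 - n * p 1) (p 1) := by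
    convert (hB.max (isZMapOn1_apply P 1)).lin_comb hc 1 (-1) 0 using 2
    push_cast; ring
  have h0 : IsZMapOn1 P fun _ => (0 : ℝ) := by
    convert hB.lin_comb hB 0 0 0 using 2
    simp
  have hx := h0.max (hb.lin_comb
    (h0.min (hb.lin_comb hc (-(Nat.fib (n + 1))) (-(Nat.fib (n + 2))) 1)) 1 1 0)
  refine IsZMapOn.of_apply fun i => ?_
  fin_cases i
  · convert hx.lin_comb hc 1 (n + 1) 0 using 2
    simp only [foldMap]
    push_cast
    simp
    ring_nf
  · exact hc

theorem Utri_succ_subset {n : ℕ} (hn : 1 ≤ n) : Utri (n + 1) ⊆ Utri n := by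
  intro p hp
  rw [mem_Utri_iff (by omega)] at hp
  rw [mem_Utri_iff hn]
  obtain ⟨h1, h2, h3⟩ := hp
  rw [Nat.fib_add_two] at h3
  push_cast at h2 h3
  have hF : (Nat.fib n : ℝ) ≤ Nat.fib (n + 1) := by exact_mod_cast Nat.fib_le_fib_succ
  refine ⟨h1, by linarith, ?_⟩
  nlinarith [mul_nonneg (sub_nonneg.2 hF) h2]

theorem mapsTo_swapMap {n : ℕ} (hn : 1 ≤ n) : MapsTo (swapMap n) (Utri (n + 1)) (Utri n) := by
  intro p hp
  rw [mem_Utri_iff (by omega)] at hp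
  rw [mem_Utri_iff hn]
  obtain ⟨h1, h2, h3⟩ := hp
  rw [Nat.fib_add_two] at h3
  push_cast at h2 h3
  simp only [swapMap, Matrix.cons_val_zero, Matrix.cons_val_one]
  refine ⟨by linarith, by linarith, ?_⟩
  linarith

theorem mapsTo_foldMap {n : ℕ} (hn : 1 ≤ n) : MapsTo (foldMap n) (Utri n) (Utri (n + 1)) := by
  intro p hp
  rw [mem_Utri_iff hn] at hp
  rw [mem_Utri_iff (by omega)]
  obtain ⟨h1, h2, h3⟩ := hp
  have hF : (Nat.fib n : ℝ) ≤ Nat.fib (n + 1) := by exact_mod_cast Nat.fib_le_fib_succ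
  have hF1 : (1 : ℝ) ≤ Nat.fib (n + 1) := by exact_mod_cast Nat.fib_pos.2 n.succ_pos
  have hF0 : (0 : ℝ) ≤ Nat.fib n := Nat.cast_nonneg _
  simp only [foldMap, Matrix.cons_val_zero, Matrix.cons_val_one]
  set B := p 0 - n * p 1 with hB
  set c := min B (p 1) with hc
  have hc0 : 0 ≤ c := le_min h2 h1
  have hb0 : 0 ≤ max B (p 1) - c := sub_nonneg.2 (min_le_left _ _ |>.trans (le_max_left _ _))
  have hle : Nat.fib n * (max B (p 1) - c) + Nat.fib (n + 2) * c ≤ 1 := by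
    rw [Nat.fib_add_two]
    push_cast
    rcases le_total B (p 1) with h | h
    · rw [hc, min_eq_left h, max_eq_right h]
      nlinarith [mul_nonneg (sub_nonneg.2 hF) (sub_nonneg.2 h)]
    · rw [hc, min_eq_right h, max_eq_left h]
      nlinarith
  generalize max B (p 1) - c = b at *
  refine ⟨hc0, ?_, ?_⟩
  · push_cast
    linarith [le_max_left 0 (b + min 0 (1 - Nat.fib (n + 1) * b - Nat.fib (n + 2) * c))]
  · push_cast
    rw [add_sub_cancel_right]
    rcases le_total 0 (1 - Nat.fib (n + 1) * b - Nat.fib (n + 2) * c) with h | h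
    · rw [min_eq_left h, add_zero, max_eq_right hb0]
      change (Nat.fib (n + 1) : ℝ) * b + Nat.fib (n + 2) * c ≤ 1
      linarith
    · rw [min_eq_right h]
      change (Nat.fib (n + 1) : ℝ) * _ + Nat.fib (n + 2) * c ≤ 1
      rcases max_cases 0 (b + (1 - Nat.fib (n + 1) * b - Nat.fib (n + 2) * c)) with h' | h'
      · rw [h'.1]
        nlinarith [mul_nonneg hF0 hb0]
      · rw [h'.1]
        nlinarith

theorem foldMap_eq_self {n : ℕ} {p : Fin 2 → ℝ} (hp : p ∈ Utri (n + 1)) : foldMap n p = p := by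
  rw [mem_Utri_iff (by omega)] at hp
  obtain ⟨h1, h2, h3⟩ := hp
  change _ + (Nat.fib (n + 2) : ℝ) * p 1 ≤ 1 at h3
  push_cast at h2 h3
  have hle : p 1 ≤ p 0 - n * p 1 := by linarith
  have hb : (0 : ℝ) ≤ p 0 - n * p 1 - p 1 := by linarith
  simp only [foldMap, min_eq_right hle, max_eq_left hle]
  rw [min_eq_left (by linarith), add_zero, max_eq_right hb]
  ext i
  fin_cases i
  · simp; ring
  · simp

theorem exists_swapMap_ne (n : ℕ) : ∃ p ∈ Utri (n + 1), swapMap n p ≠ p := by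
  refine ⟨![1 / (Nat.fib (n + 1) : ℝ), 0], subset_convexHull ℝ _ (by simp), fun h => ?_⟩
  simpa [swapMap] using congrFun h 1

theorem IsIntAffine.eq_of_eqOn_Utri {n : ℕ} (hn : 1 ≤ n) {f g : (Fin 2 → ℝ) → (Fin 2 → ℝ)}
    (hf : IsIntAffine f) (hg : IsIntAffine g) (h : EqOn f g (Utri n)) : f = g := by
  obtain ⟨M, b, hM⟩ := hf
  obtain ⟨N, c, hN⟩ := hg
  have hF : (0 : ℝ) < Nat.fib n := by exact_mod_cast Nat.fib_pos.2 hn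
  have hF' : (0 : ℝ) < Nat.fib (n + 1) := by exact_mod_cast Nat.fib_pos.2 n.succ_pos
  ext x i
  have h0 := congrFun (h (subset_convexHull ℝ _ (by simp) : ![0, 0] ∈ Utri n)) i
  have h1 := congrFun (h (subset_convexHull ℝ _ (by simp) : ![1 / (Nat.fib n : ℝ), 0] ∈ Utri n)) i
  have h2 := congrFun (h (subset_convexHull ℝ _ (by simp) :
    ![(n : ℝ) / (Nat.fib (n + 1) : ℝ), 1 / (Nat.fib (n + 1) : ℝ)] ∈ Utri n)) i
  simp only [hM, hN, Fin.sum_univ_two, Matrix.cons_val_zero, Matrix.cons_val_one, mul_zero,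
    zero_add, add_zero] at h0 h1 h2 ⊢
  rw [h0, add_left_inj] at h1 h2
  have e0 := mul_right_cancel₀ (by positivity) h1
  rw [e0, add_right_inj] at h2
  rw [e0, mul_right_cancel₀ (by positivity) h2, h0]

theorem exists_retraction_onto_Utri {n : ℕ} (hn : 1 ≤ n) :
    Utri n ⊆ cubeSet 2 ∧ ∃ σ : (Fin 2 → ℝ) → (Fin 2 → ℝ), IsZRetraction σ ∧ zRange σ = Utri n ∧
      ∃ H : Finset ((Fin 2 → ℝ) → (Fin 2 → ℝ)), 2 ^ n ≤ H.card ∧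
        ∀ h ∈ H, IsIntAffine h ∧ MapsTo h (Utri n) (cubeSet 2) ∧ ∀ u ∈ Utri n, σ (h u) = u := by
  classical
  induction n, hn using Nat.le_induction with
  | base =>
    have hmem : ∀ p : Fin 2 → ℝ, p ∈ Utri 1 ↔ 0 ≤ p 1 ∧ p 1 ≤ p 0 ∧ p 0 ≤ 1 := by
      intro p
      simp [mem_Utri_iff le_rfl]
    have hcube : ∀ p : Fin 2 → ℝ, p ∈ cubeSet 2 ↔ (0 ≤ p 0 ∧ 0 ≤ p 1) ∧ p 0 ≤ 1 ∧ p 1 ≤ 1 := by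
      intro p
      simp [cubeSet, Pi.le_def, Fin.forall_fin_two]
    have hsub : Utri 1 ⊆ cubeSet 2 := by
      intro p hp
      rw [hmem] at hp
      rw [hcube]
      exact ⟨⟨by linarith, by linarith⟩, by linarith, by linarith⟩
    let σ : (Fin 2 → ℝ) → (Fin 2 → ℝ) := fun p => ![max (p 0) (p 1), min (p 0) (p 1)]
    let τ : (Fin 2 → ℝ) → (Fin 2 → ℝ) := fun p => ![p 1, p 0]
    have hfix : ∀ p ∈ Utri 1, σ p = p := by
      intro p hp
      rw [hmem] at hp
      ext i
      fin_cases i <;> simp [σ, hp.2.1]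
    have hmaps : MapsTo σ (cubeSet 2) (Utri 1) := by
      intro p hp
      rw [hcube] at hp
      rw [hmem]
      simp only [σ, Matrix.cons_val_zero, Matrix.cons_val_one]
      exact ⟨le_min hp.1.1 hp.1.2, min_le_max, max_le hp.2.1 hp.2.2⟩
    refine ⟨hsub, σ, ⟨IsZMapOn.of_apply fun i => ?_, fun p hp => hsub (hmaps hp),
      fun p hp => hfix _ (hmaps hp)⟩, ?_, {id, τ}, ?_, ?_⟩
    · fin_cases i
      · exact (isZMapOn1_apply _ 0).max (isZMapOn1_apply _ 1)
      · exact (isZMapOn1_apply _ 0).min (isZMapOn1_apply _ 1)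
    · exact hmaps.image_subset.antisymm fun p hp => ⟨p, hsub hp, hfix p hp⟩
    · rw [Finset.card_pair, pow_one]
      intro h
      simpa [τ] using congrFun (congrFun h ![0, 1]) 0
    · intro h hh
      rcases Finset.mem_insert.1 hh with rfl | hh
      · exact ⟨⟨![![1, 0], ![0, 1]], 0, fun x i => by fin_cases i <;> simp⟩, hsub, hfix⟩
      · rw [Finset.mem_singleton.1 hh]
        refine ⟨⟨![![0, 1], ![1, 0]], 0, fun x i => by fin_cases i <;> simp [τ]⟩, ?_, ?_⟩
        · intro p hp
          have := (hcube p).1 (hsub hp)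
          rw [hcube]
          exact ⟨this.1.symm, this.2.symm⟩
        · intro p hp
          rw [← hfix p hp]
          simp [σ, τ]
  | succ n hn ih =>
    obtain ⟨hsub, σ, ⟨hσz, hσm, hσi⟩, hσr, H, hcard, hH⟩ := ih
    have hsub' := (Utri_succ_subset hn).trans hsub
    have hσU : MapsTo σ (cubeSet 2) (Utri n) := fun p hp => hσr ▸ mem_image_of_mem σ hp
    have hσfix : ∀ p ∈ Utri n, σ p = p := by
      intro p hp
      rw [← hσr] at hp
      obtain ⟨q, hq, rfl⟩ := hp
      exact hσi q hq
    have hmaps : MapsTo (foldMap n ∘ σ) (cubeSet 2) (Utri (n + 1)) :=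
      (mapsTo_foldMap hn).comp hσU
    have hfix : ∀ p ∈ Utri (n + 1), (foldMap n ∘ σ) p = p := by
      intro p hp
      rw [Function.comp_apply, hσfix p (Utri_succ_subset hn hp), foldMap_eq_self hp]
    refine ⟨hsub', foldMap n ∘ σ, ⟨(isZMapOn_foldMap n univ).comp hσz (mapsTo_univ _ _),
      fun p hp => hsub' (hmaps hp), fun p hp => hfix _ (hmaps hp)⟩,
      hmaps.image_subset.antisymm fun p hp => ⟨p, hsub' hp, hfix p hp⟩,
      H ∪ H.image (· ∘ swapMap n), ?_, ?_⟩
    · rw [Finset.card_union_of_disjoint, Finset.card_image_of_injective]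
      · rw [pow_succ]; omega
      · exact (swapMap_involutive n).surjective.injective_comp_right
      · rw [Finset.disjoint_left]
        rintro _ hf hf'
        obtain ⟨g, hg, rfl⟩ := Finset.mem_image.1 hf'
        obtain ⟨p, hp, hne⟩ := exists_swapMap_ne n
        apply hne
        rw [← (hH g hg).2.2 _ (mapsTo_swapMap hn hp)]
        exact (hH _ hf).2.2 p (Utri_succ_subset hn hp)
    · intro h hh
      rcases Finset.mem_union.1 hh with hh | hh
      · obtain ⟨h1, h2, h3⟩ := hH h hh
        refine ⟨h1, h2.mono_left (Utri_succ_subset hn), fun u hu => ?_⟩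
        rw [Function.comp_apply, h3 u (Utri_succ_subset hn hu), foldMap_eq_self hu]
      · obtain ⟨g, hg, rfl⟩ := Finset.mem_image.1 hh
        obtain ⟨h1, h2, h3⟩ := hH g hg
        refine ⟨h1.comp (isIntAffine_swapMap n), h2.comp (mapsTo_swapMap hn), fun u hu => ?_⟩
        rw [Function.comp_apply, Function.comp_apply, h3 _ (mapsTo_swapMap hn hu),
          foldMap_swapMap, foldMap_eq_self hu]

theorem IsIntAffine.image_convexHull {n m : ℕ} {g : (Fin n → ℝ) → (Fin m → ℝ)}
    (hg : IsIntAffine g) (s : Set (Fin n → ℝ)) :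
    g '' convexHull ℝ s = convexHull ℝ (g '' s) := by
  obtain ⟨M, b, hM⟩ := hg
  let A : Matrix (Fin m) (Fin n) ℝ := Matrix.of fun i j => (M i j : ℝ)
  let G : (Fin n → ℝ) →ᵃ[ℝ] (Fin m → ℝ) :=
    A.mulVecLin.toAffineMap + AffineMap.const ℝ _ fun i => (b i : ℝ)
  have : g = G := by
    ext x i
    simp [G, A, hM, Matrix.mulVec, dotProduct]
  rw [this]
  exact G.image_convexHull s

theorem IsIntAffine.isRationalPoint {n m : ℕ} {g : (Fin n → ℝ) → (Fin m → ℝ)}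
    (hg : IsIntAffine g) {v : Fin n → ℝ} (hv : IsRationalPoint v) : IsRationalPoint (g v) := by
  obtain ⟨M, b, hM⟩ := hg
  choose q hq using hv
  exact fun i => ⟨∑ j, M i j * q j + b i, by simp [hM, hq]⟩

theorem isRationalPolyhedron_image_Utri {n : ℕ} {h : (Fin 2 → ℝ) → (Fin 2 → ℝ)}
    (hh : IsIntAffine h) : IsRationalPolyhedron (h '' Utri n) := by
  classical
  let V : Finset (Fin 2 → ℝ) := {![0, 0], ![1 / (Nat.fib n : ℝ), 0],
    ![(n : ℝ) / (Nat.fib (n + 1) : ℝ), 1 / (Nat.fib (n + 1) : ℝ)]}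
  refine ⟨{V.image h}, ?_, ?_⟩
  · intro F hF v hv
    rw [Finset.mem_singleton.1 hF] at hv
    obtain ⟨w, hw, rfl⟩ := Finset.mem_image.1 hv
    refine hh.isRationalPoint ?_
    simp only [V, Finset.mem_insert, Finset.mem_singleton] at hw
    rw [IsRationalPoint, Fin.forall_fin_two]
    rcases hw with rfl | rfl | rfl
    · exact ⟨⟨0, by simp⟩, ⟨0, by simp⟩⟩
    · exact ⟨⟨1 / Nat.fib n, by simp⟩, ⟨0, by simp⟩⟩
    · exact ⟨⟨n / Nat.fib (n + 1), by simp⟩, ⟨1 / Nat.fib (n + 1), by simp⟩⟩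
  · simp [Utri, hh.image_convexHull, V, image_insert_eq]

theorem isZHomeoDomain_image {n : ℕ} {σ h : (Fin 2 → ℝ) → (Fin 2 → ℝ)} (hσ : IsZRetraction σ)
    (hr : zRange σ = Utri n) (hh : IsIntAffine h) (hm : MapsTo h (Utri n) (cubeSet 2))
    (hs : ∀ u ∈ Utri n, σ (h u) = u) : IsZHomeoDomain σ (h '' Utri n) := by
  have hinv : ∀ x ∈ h '' Utri n, h (σ x) = x := by
    rintro _ ⟨u, hu, rfl⟩
    rw [hs u hu]
  refine ⟨isRationalPolyhedron_image_Utri hh, hm.image_subset, hσ.1.mono hm.image_subset, ?_,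
    fun x hx y hy hxy => ?_, h, hh.isZMapOn, hinv, hr ▸ hs⟩
  · rw [hr, image_image]
    exact (image_congr hs).trans (image_id' _)
  · rw [← hinv x hx, ← hinv y hy, hxy]

theorem exists_retraction_many_domains {n : ℕ} (hn : 1 ≤ n) :
    ∃ σ : (Fin 2 → ℝ) → (Fin 2 → ℝ), IsZRetraction σ ∧ zRange σ = Utri n ∧
      {Q : Set (Fin 2 → ℝ) | IsZHomeoDomain σ Q}.Finite ∧
      2 ^ n ≤ Nat.card {Q : Set (Fin 2 → ℝ) // IsZHomeoDomain σ Q} := by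
  obtain ⟨-, σ, hσ, hr, H, hcard, hH⟩ := exists_retraction_onto_Utri hn
  have hfin : {Q : Set (Fin 2 → ℝ) | IsZHomeoDomain σ Q}.Finite :=
    finite_setOf_isZHomeoDomain hσ (hr ▸ convex_Utri n) (hr ▸ Utri_subset_closure_interior hn)
  refine ⟨σ, hσ, hr, hfin, hcard.trans ?_⟩
  have : Finite {Q : Set (Fin 2 → ℝ) // IsZHomeoDomain σ Q} := hfin.to_subtype
  let f : H → {Q : Set (Fin 2 → ℝ) // IsZHomeoDomain σ Q} := fun h =>
    ⟨h.1 '' Utri n, isZHomeoDomain_image hσ hr (hH h h.2).1 (hH h h.2).2.1 (hH h h.2).2.2⟩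
  rw [← Nat.card_eq_finsetCard]
  refine Nat.card_le_card_of_injective f fun g h hgh => Subtype.ext ?_
  refine (hH g g.2).1.eq_of_eqOn_Utri hn (hH h h.2).1 fun u hu => ?_
  obtain ⟨w, hw, hwu⟩ : g.1 u ∈ h.1 '' Utri n := by
    have himg : g.1 '' Utri n = h.1 '' Utri n := congrArg Subtype.val hgh
    exact himg.subset (mem_image_of_mem g.1 hu)
  have : w = u := by
    rw [← (hH h h.2).2.2 w hw, hwu, (hH g g.2).2.2 u hu]
  rw [← hwu, this]

/-- For every `n ≥ 1` there is a Z-retraction of `[0,1]²` with range `U_n`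
having at least `2^n` Z-homeomorphism domains, while every Z-retraction with range `U_n`
has only finitely many; in particular, for every `j` there is a retract of `McN([0,1]²)`
of finite multiplicity greater than `j`. -/
theorem stmt15 :
    (∀ n : ℕ, 1 ≤ n →
      (∃ σ : (Fin 2 → ℝ) → (Fin 2 → ℝ), IsZRetraction σ ∧ zRange σ = Utri n ∧
        {Q : Set (Fin 2 → ℝ) | IsZHomeoDomain σ Q}.Finite ∧
        2 ^ n ≤ Nat.card {Q : Set (Fin 2 → ℝ) // IsZHomeoDomain σ Q}) ∧
      (∀ σ : (Fin 2 → ℝ) → (Fin 2 → ℝ), IsZRetraction σ → zRange σ = Utri n →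
        {Q : Set (Fin 2 → ℝ) | IsZHomeoDomain σ Q}.Finite)) ∧
    (∀ j : ℕ, ∃ σ : (Fin 2 → ℝ) → (Fin 2 → ℝ), IsZRetraction σ ∧
      {Q : Set (Fin 2 → ℝ) | IsZHomeoDomain σ Q}.Finite ∧
      j < Nat.card {Q : Set (Fin 2 → ℝ) // IsZHomeoDomain σ Q}) := by
  refine ⟨fun n hn => ⟨exists_retraction_many_domains hn, fun σ hσ hr =>
    finite_setOf_isZHomeoDomain hσ (hr ▸ convex_Utri n)
      (hr ▸ Utri_subset_closure_interior hn)⟩, fun j => ?_⟩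
  obtain ⟨σ, hσ, -, hfin, hcard⟩ := exists_retraction_many_domains (n := j + 1) (by omega)
  exact ⟨σ, hσ, hfin, (j.lt_succ_self.trans Nat.lt_two_pow_self).trans_le hcard⟩
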